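/- arXiv:2002.01507 — 2 statements merged into one kernel-verified Lean document; each statement's English description precedes it below -/
import Mathlib

section
/- Let ψ = Ω e^{iS/ħ} be a pure state on ℝⁿ, with momentum means p_j := ∫ ψ̄ (−iħ ∂_jψ) dq and momentum covariance matrix Ṽ_{jk} := ħ² Re ∫ ∂_jψ̄ ∂_kψ dq − p_j p_k. Then Ṽ decomposes as Ṽ = Ṽ_c + Ṽ_nc, where (Ṽ_c)_{jk} := Cov(∂_jS, ∂_kS) (covariance with respect to the probability density Ω²) and (Ṽ_nc)_{jk} := −ħ² ∫ Ω ∂_j∂_kΩ dq. -/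
open MeasureTheory Matrix Filter

/-- Partial derivative `∂ⱼ f` of a real-valued function on `ℝⁿ`. -/
noncomputable def pd {n : ℕ} (j : Fin n) (f : (Fin n → ℝ) → ℝ) (q : Fin n → ℝ) : ℝ :=
  fderiv ℝ f q (Pi.single j 1)

/-- Partial derivative `∂ⱼ f` of a complex-valued function on `ℝⁿ`. -/
noncomputable def pdC {n : ℕ} (j : Fin n) (f : (Fin n → ℝ) → ℂ) (q : Fin n → ℝ) : ℂ :=
  fderiv ℝ f q (Pi.single j 1)

/-- Mean value `⟨T⟩ = ∫ Ω² T` with respect to the probability density `Ω²`. -/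
noncomputable def expec {n : ℕ} (Ω T : (Fin n → ℝ) → ℝ) : ℝ :=
  ∫ q, (Ω q) ^ 2 * T q

/-- Covariance `Cov(T,T') = ⟨TT'⟩ - ⟨T⟩⟨T'⟩` with respect to `Ω²`. -/
noncomputable def cov {n : ℕ} (Ω T T' : (Fin n → ℝ) → ℝ) : ℝ :=
  expec Ω (fun q => T q * T' q) - expec Ω T * expec Ω T'

/-- The pure state `ψ = Ω e^{iS/ħ}`. -/
noncomputable def pureState {n : ℕ} (hbar : ℝ) (Ω S : (Fin n → ℝ) → ℝ)
    (q : Fin n → ℝ) : ℂ :=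
  (Ω q : ℂ) * Complex.exp (Complex.I * (S q : ℂ) / (hbar : ℂ))

/-- The momentum mean `pⱼ = ∫ ψ̄ (-iħ ∂ⱼψ)`. -/
noncomputable def momMean {n : ℕ} (hbar : ℝ) (Ω S : (Fin n → ℝ) → ℝ) (j : Fin n) : ℂ :=
  ∫ q, (starRingEnd ℂ) (pureState hbar Ω S q) *
    (-(hbar : ℂ) * Complex.I * pdC j (pureState hbar Ω S) q)

theorem pdC_pureState {n : ℕ} (hbar : ℝ) {Ω S : (Fin n → ℝ) → ℝ} {q : Fin n → ℝ}
    (hΩ : DifferentiableAt ℝ Ω q) (hS : DifferentiableAt ℝ S q) (j : Fin n) :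
    pdC j (pureState hbar Ω S) q =
      ((pd j Ω q : ℂ) + Complex.I * (Ω q * pd j S q / hbar : ℝ)) *
        Complex.exp (Complex.I * (S q : ℂ) / (hbar : ℂ)) := by
  have h1 : HasFDerivAt (fun x => (Ω x : ℂ)) (Complex.ofRealCLM.comp (fderiv ℝ Ω q)) q :=
    Complex.ofRealCLM.hasFDerivAt.comp q hΩ.hasFDerivAt
  have h2 : HasFDerivAt (fun x => (S x : ℂ)) (Complex.ofRealCLM.comp (fderiv ℝ S q)) q :=
    Complex.ofRealCLM.hasFDerivAt.comp q hS.hasFDerivAt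
  have h3 := h1.mul ((h2.const_mul (Complex.I / (hbar : ℂ))).cexp)
  have h4 : pureState hbar Ω S = (fun x => (Ω x : ℂ)) *
      fun x => Complex.exp (Complex.I / (hbar : ℂ) * (S x : ℂ)) := by
    funext x
    simp only [pureState, Pi.mul_apply]
    congr 2
    ring
  rw [pdC, h4, h3.fderiv, show Complex.I * (S q : ℂ) / (hbar : ℂ) =
    Complex.I / (hbar : ℂ) * (S q : ℂ) by ring]
  simp [pd]
  ring

theorem conj_mul_self_exp_I_mul (s hbar : ℝ) :
    (starRingEnd ℂ) (Complex.exp (Complex.I * (s : ℂ) / (hbar : ℂ))) *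
      Complex.exp (Complex.I * (s : ℂ) / (hbar : ℂ)) = 1 := by
  rw [← Complex.exp_conj, ← Complex.exp_add, ← Complex.exp_zero]
  congr 1
  simp
  ring

theorem re_conj_pdC_mul_pdC {n : ℕ} (hbar : ℝ) {Ω S : (Fin n → ℝ) → ℝ} {q : Fin n → ℝ}
    (hΩ : DifferentiableAt ℝ Ω q) (hS : DifferentiableAt ℝ S q) (j k : Fin n) :
    ((starRingEnd ℂ) (pdC j (pureState hbar Ω S) q) * pdC k (pureState hbar Ω S) q).re =
      pd j Ω q * pd k Ω q + (hbar ^ 2)⁻¹ * ((Ω q) ^ 2 * (pd j S q * pd k S q)) := by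
  rw [pdC_pureState hbar hΩ hS, pdC_pureState hbar hΩ hS, map_mul, mul_mul_mul_comm,
    conj_mul_self_exp_I_mul, mul_one]
  simp only [map_add, map_mul, Complex.conj_ofReal, Complex.conj_I, Complex.mul_re,
    Complex.add_re, Complex.add_im, Complex.mul_im, Complex.neg_re, Complex.neg_im,
    Complex.I_re, Complex.I_im, Complex.ofReal_re, Complex.ofReal_im]
  ring

theorem conj_pureState_mul_momentum {n : ℕ} {hbar : ℝ} (hh : hbar ≠ 0)
    {Ω S : (Fin n → ℝ) → ℝ} {q : Fin n → ℝ}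
    (hΩ : DifferentiableAt ℝ Ω q) (hS : DifferentiableAt ℝ S q) (j : Fin n) :
    (starRingEnd ℂ) (pureState hbar Ω S q) *
        (-(hbar : ℂ) * Complex.I * pdC j (pureState hbar Ω S) q) =
      ((Ω q ^ 2 * pd j S q : ℝ) : ℂ) +
        ((-(hbar / 2) * pd j (fun x => Ω x ^ 2) q : ℝ) : ℂ) * Complex.I := by
  have hsq : pd j (fun x => Ω x ^ 2) q = 2 * Ω q * pd j Ω q := by
    simp [pd, (hΩ.hasFDerivAt.pow 2).fderiv]
  have hh' : (hbar : ℂ) ≠ 0 := by exact_mod_cast hh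
  have hE := conj_mul_self_exp_I_mul (S q) hbar
  rw [pdC_pureState hbar hΩ hS, hsq]
  simp only [pureState, map_mul, Complex.conj_ofReal]
  push_cast
  generalize Complex.exp (Complex.I * (S q : ℂ) / (hbar : ℂ)) = E at hE ⊢
  field_simp
  linear_combination (-Complex.I * Ω q * (hbar * pd j Ω q + Complex.I * Ω q * pd j S q)) * hE -
    (Ω q : ℂ) ^ 2 * pd j S q * Complex.I_sq

theorem momMean_eq_expec {n : ℕ} {hbar : ℝ} (hh : hbar ≠ 0) {Ω S : (Fin n → ℝ) → ℝ}
    (hΩ : Differentiable ℝ Ω) (hS : Differentiable ℝ S) (j : Fin n)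
    (hint : Integrable (fun q => (starRingEnd ℂ) (pureState hbar Ω S q) *
      (-(hbar : ℂ) * Complex.I * pdC j (pureState hbar Ω S) q)))
    (hbd : ∫ q, pd j (fun x => (Ω x) ^ 2) q = 0) :
    momMean hbar Ω S j = (expec Ω (pd j S) : ℂ) := by
  have hpt := fun q => conj_pureState_mul_momentum hh (hΩ q) (hS q) j
  have hre := Complex.reCLM.integral_comp_comm hint
  have him := Complex.imCLM.integral_comp_comm hint
  simp only [hpt, Complex.reCLM_apply, Complex.imCLM_apply, Complex.add_re, Complex.add_im,
    Complex.re_ofReal_mul, Complex.im_ofReal_mul, Complex.I_re, Complex.I_im, Complex.ofReal_re,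
    Complex.ofReal_im, mul_zero, mul_one, add_zero, zero_add] at hre him
  rw [integral_const_mul, hbd, mul_zero] at him
  simp only [momMean, expec, hpt]
  exact Complex.ext (by simpa using hre.symm) (by simpa using him.symm)

theorem integral_pd_mul_pd {n : ℕ} {Ω : (Fin n → ℝ) → ℝ} (hΩ : ContDiff ℝ 2 Ω) (j k : Fin n)
    (hint : Integrable (fun q => pd j Ω q * pd k Ω q))
    (hint' : Integrable (fun q => Ω q * pd j (pd k Ω) q))
    (hbd : ∫ q, pd j (fun x => Ω x * pd k Ω x) q = 0) :
    ∫ q, pd j Ω q * pd k Ω q = -∫ q, Ω q * pd j (pd k Ω) q := by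
  have hd : Differentiable ℝ Ω := hΩ.differentiable (by norm_num)
  have hd' : Differentiable ℝ (pd k Ω) :=
    ((hΩ.fderiv_right (m := 1) (by norm_num)).clm_apply contDiff_const).differentiable (by norm_num)
  have hpt : ∀ q, pd j (fun x => Ω x * pd k Ω x) q =
      pd j Ω q * pd k Ω q + Ω q * pd j (pd k Ω) q := by
    intro q
    have h := ((hd q).hasFDerivAt.mul (hd' q).hasFDerivAt).fderiv
    change fderiv ℝ (Ω * pd k Ω) q (Pi.single j 1) = _
    rw [h]
    simp only [pd, _root_.add_apply, _root_.smul_apply, smul_eq_mul]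
    ring
  simp only [hpt] at hbd
  rw [integral_add hint hint'] at hbd
  linarith

/-- the momentum covariance matrix decomposes as `Ṽ = Ṽc + Ṽnc`,
where `(Ṽc)ⱼₖ = Cov(∂ⱼS, ∂ₖS)` and `(Ṽnc)ⱼₖ = -ħ² ∫ Ω ∂ⱼ∂ₖΩ`. -/
theorem momentum_covariance_decomposition {n : ℕ} (hn : 1 ≤ n)
    (hbar : ℝ) (hhbar : 0 < hbar)
    (Ω : (Fin n → ℝ) → ℝ) (hΩc : ContDiff ℝ 2 Ω) (hΩpos : ∀ q, 0 < Ω q)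
    (hΩnorm : ∫ q, (Ω q) ^ 2 = 1)
    (S : (Fin n → ℝ) → ℝ) (hSc : ContDiff ℝ 2 S)
    -- all integrals appearing converge absolutely
    (hint1 : ∀ j, Integrable (fun q => (Ω q) ^ 2 * pd j S q))
    (hint2 : ∀ j k, Integrable (fun q => (Ω q) ^ 2 * (pd j S q * pd k S q)))
    (hint3 : ∀ j k, Integrable (fun q => pd j Ω q * pd k Ω q))
    (hint4 : ∀ j k, Integrable (fun q => Ω q * pd j (pd k Ω) q))
    (hint5 : ∀ j k, Integrable (fun q =>
      (starRingEnd ℂ) (pdC j (pureState hbar Ω S) q) * pdC k (pureState hbar Ω S) q))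
    (hint6 : ∀ j, Integrable (fun q => (starRingEnd ℂ) (pureState hbar Ω S q) *
      (-(hbar : ℂ) * Complex.I * pdC j (pureState hbar Ω S) q)))
    -- all boundary terms in integration by parts vanish
    (hbd1 : ∀ k, ∫ q, pd k (fun x => (Ω x) ^ 2) q = 0)
    (hbd2 : ∀ j k, ∫ q, pd j (fun x => Ω x * pd k Ω x) q = 0) :
    ∀ j k : Fin n,
      hbar ^ 2 * (∫ q, (starRingEnd ℂ) (pdC j (pureState hbar Ω S) q) *
            pdC k (pureState hbar Ω S) q).re -
          (momMean hbar Ω S j * momMean hbar Ω S k).re =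
        cov Ω (pd j S) (pd k S) + (-hbar ^ 2 * ∫ q, Ω q * pd j (pd k Ω) q) := by
  intro j k
  have hh : hbar ≠ 0 := hhbar.ne'
  have hΩd : Differentiable ℝ Ω := hΩc.differentiable (by norm_num)
  have hSd : Differentiable ℝ S := hSc.differentiable (by norm_num)
  have hre := Complex.reCLM.integral_comp_comm (hint5 j k)
  simp only [Complex.reCLM_apply, re_conj_pdC_mul_pdC hbar (hΩd _) (hSd _)] at hre
  rw [← hre, integral_add (hint3 j k) ((hint2 j k).const_mul _), integral_const_mul,
    integral_pd_mul_pd hΩc j k (hint3 j k) (hint4 j k) (hbd2 j k),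
    momMean_eq_expec hh hΩd hSd j (hint6 j) (hbd1 j),
    momMean_eq_expec hh hΩd hSd k (hint6 k) (hbd1 k), ← Complex.ofReal_mul, Complex.ofReal_re, cov]
  simp only [expec]
  field_simp
  ring
end

section
/- Let Ω be the Gaussian probability amplitude on ℝⁿ with mean η and position covariance matrix V, and let M be an n×n real symmetric positive definite matrix. Then the mean value of the quantum potential is exactly ⟨Q⟩ = (ħ²/8) Tr(V⁻¹ M). -/
open MeasureTheory Matrix

/-- Mean value of the quantum potential `⟨Q⟩ = -(ħ²/2) ∫ Ω Σⱼₖ Mⱼₖ ∂ⱼ∂ₖΩ`. -/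
noncomputable def meanQ {n : ℕ} (hbar : ℝ) (M : Matrix (Fin n) (Fin n) ℝ)
    (Ω : (Fin n → ℝ) → ℝ) : ℝ :=
  -(hbar ^ 2 / 2) * ∫ q, Ω q * ∑ j, ∑ k, M j k * pd j (pd k Ω) q

/-- The Gaussian probability amplitude on `ℝⁿ` with mean `η` and position covariance
matrix `V`:  `Ω(q) = ((2π)ⁿ det V)^{-1/4} exp(-(1/4)(q-η)⋅V⁻¹(q-η))`. -/
noncomputable def gaussAmp {n : ℕ} (η : Fin n → ℝ) (V : Matrix (Fin n) (Fin n) ℝ)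
    (q : Fin n → ℝ) : ℝ :=
  ((2 * Real.pi) ^ n * V.det) ^ (-(1 / 4 : ℝ)) *
    Real.exp (-(1 / 4) * ((q - η) ⬝ᵥ V⁻¹.mulVec (q - η)))

/-- Linear change of variables for Lebesgue integrals on `ℝⁿ`. -/
lemma integral_comp_mulVec {n : ℕ} {C : Matrix (Fin n) (Fin n) ℝ} (hC : C.det ≠ 0)
    (f : (Fin n → ℝ) → ℝ) :
    ∫ x, f (C *ᵥ x) = |C.det|⁻¹ * ∫ x, f x := by
  have hmap := Real.map_matrix_volume_pi_eq_smul_volume_pi hC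
  have hemb : MeasurableEmbedding (toLin' C) :=
    ((toLin' C).isClosedEmbedding_of_injective <| LinearMap.ker_eq_bot.2 <|
      mulVec_injective_iff_isUnit.2 <| (isUnit_iff_isUnit_det C).2 hC.isUnit).measurableEmbedding
  have h := hemb.integral_map (μ := volume) f
  rw [hmap, integral_smul_measure, ENNReal.toReal_ofReal (abs_nonneg _), abs_inv] at h
  simpa using h.symm

lemma integrable_comp_mulVec {n : ℕ} {C : Matrix (Fin n) (Fin n) ℝ} (hC : C.det ≠ 0)
    {f : (Fin n → ℝ) → ℝ} (hf : Integrable f) :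
    Integrable fun x => f (C *ᵥ x) := by
  have hmap := Real.map_matrix_volume_pi_eq_smul_volume_pi hC
  have hf' : Integrable f (Measure.map (toLin' C) volume) := by
    rw [hmap]; exact hf.smul_measure ENNReal.ofReal_ne_top
  exact hf'.comp_measurable (toLin' C).continuous_of_finiteDimensional.measurable

lemma exp_neg_mul_dotProduct_self {n : ℕ} (b : ℝ) (x : Fin n → ℝ) :
    Real.exp (-b * (x ⬝ᵥ x)) = ∏ i, Real.exp (-b * x i ^ 2) := by
  rw [← Real.exp_sum, dotProduct, Finset.mul_sum]
  simp only [pow_two]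

lemma integrable_exp_neg_mul_dotProduct_self {n : ℕ} {b : ℝ} (hb : 0 < b) :
    Integrable fun x : Fin n → ℝ => Real.exp (-b * (x ⬝ᵥ x)) := by
  simp only [exp_neg_mul_dotProduct_self]
  exact Integrable.fintype_prod (f := fun _ t => Real.exp (-b * t ^ 2))
    fun _ => integrable_exp_neg_mul_sq hb

lemma integral_exp_neg_mul_dotProduct_self {n : ℕ} (b : ℝ) :
    ∫ x : Fin n → ℝ, Real.exp (-b * (x ⬝ᵥ x)) = √(Real.pi / b) ^ n := by
  simp only [exp_neg_mul_dotProduct_self]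
  rw [integral_fintype_prod_volume_eq_pow (fun t : ℝ => Real.exp (-b * t ^ 2)),
    integral_gaussian, Fintype.card_fin]

open scoped MatrixOrder in
lemma Matrix.PosDef.exists_eq_transpose_mul_self {n : ℕ} {A : Matrix (Fin n) (Fin n) ℝ}
    (hA : A.PosDef) : ∃ C : Matrix (Fin n) (Fin n) ℝ, C.det ≠ 0 ∧ A = Cᵀ * C := by
  obtain ⟨C, hC⟩ := CStarAlgebra.nonneg_iff_eq_star_mul_self.1 hA.posSemidef.nonneg
  have hC' : A = Cᵀ * C := by rw [hC, star_eq_conjTranspose, conjTranspose_eq_transpose_of_trivial]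
  refine ⟨C, fun h => hA.det_pos.ne' ?_, hC'⟩
  rw [hC', det_mul, h, mul_zero]

lemma dotProduct_transpose_mul_self_mulVec {n : ℕ} (C : Matrix (Fin n) (Fin n) ℝ)
    (x : Fin n → ℝ) : x ⬝ᵥ (Cᵀ * C) *ᵥ x = (C *ᵥ x) ⬝ᵥ (C *ᵥ x) := by
  rw [← mulVec_mulVec, dotProduct_mulVec, vecMul_transpose]

lemma Matrix.PosDef.integrable_exp_neg_mul {n : ℕ} {A : Matrix (Fin n) (Fin n) ℝ}
    (hA : A.PosDef) {b : ℝ} (hb : 0 < b) :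
    Integrable fun x : Fin n → ℝ => Real.exp (-b * (x ⬝ᵥ A *ᵥ x)) := by
  obtain ⟨C, hC, rfl⟩ := hA.exists_eq_transpose_mul_self
  simp only [dotProduct_transpose_mul_self_mulVec]
  exact integrable_comp_mulVec hC (integrable_exp_neg_mul_dotProduct_self hb)

lemma Matrix.PosDef.integral_exp_neg_mul {n : ℕ} {A : Matrix (Fin n) (Fin n) ℝ}
    (hA : A.PosDef) (b : ℝ) :
    ∫ x : Fin n → ℝ, Real.exp (-b * (x ⬝ᵥ A *ᵥ x)) = (√A.det)⁻¹ * √(Real.pi / b) ^ n := by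
  obtain ⟨C, hC, rfl⟩ := hA.exists_eq_transpose_mul_self
  simp only [dotProduct_transpose_mul_self_mulVec]
  rw [integral_comp_mulVec hC (fun y => Real.exp (-b * (y ⬝ᵥ y))),
    integral_exp_neg_mul_dotProduct_self, det_mul, det_transpose, Real.sqrt_mul_self_eq_abs]

lemma Matrix.PosDef.exists_sq_mulVec_le {n : ℕ} {A : Matrix (Fin n) (Fin n) ℝ}
    (hA : A.PosDef) (j : Fin n) :
    ∃ K, 0 ≤ K ∧ ∀ x : Fin n → ℝ, ((A *ᵥ x) j) ^ 2 ≤ K * (x ⬝ᵥ A *ᵥ x) := by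
  obtain ⟨C, hC, rfl⟩ := hA.exists_eq_transpose_mul_self
  refine ⟨∑ i, C i j ^ 2, Finset.sum_nonneg fun _ _ => sq_nonneg _, fun x => ?_⟩
  rw [dotProduct_transpose_mul_self_mulVec, ← mulVec_mulVec]
  simpa [mulVec, dotProduct, pow_two] using
    Finset.sum_mul_sq_le_sq_mul_sq Finset.univ (fun i => C i j) (C *ᵥ x)

lemma Matrix.PosDef.integrable_sq_mulVec_mul_exp {n : ℕ} {A : Matrix (Fin n) (Fin n) ℝ}
    (hA : A.PosDef) {b : ℝ} (hb : 0 < b) (j : Fin n) :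
    Integrable fun x : Fin n → ℝ => ((A *ᵥ x) j) ^ 2 * Real.exp (-b * (x ⬝ᵥ A *ᵥ x)) := by
  obtain ⟨K, hK, h⟩ := hA.exists_sq_mulVec_le j
  refine ((hA.integrable_exp_neg_mul (half_pos hb)).const_mul (K * (2 / b))).mono' ?_ ?_
  · exact Continuous.aestronglyMeasurable (by unfold Matrix.mulVec dotProduct; fun_prop)
  · refine Filter.Eventually.of_forall fun x => ?_
    rw [Real.norm_of_nonneg (by positivity)]
    set Q := x ⬝ᵥ A *ᵥ x
    have h1 : Q ≤ 2 / b * Real.exp (b / 2 * Q) := by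
      have := Real.add_one_le_exp (b / 2 * Q)
      calc Q = 2 / b * (b / 2 * Q) := by field_simp
        _ ≤ _ := by gcongr; linarith
    have h2 : Real.exp (-(b / 2) * Q) = Real.exp (b / 2 * Q) * Real.exp (-b * Q) := by
      rw [← Real.exp_add]; ring_nf
    rw [h2, ← mul_assoc]
    refine mul_le_mul_of_nonneg_right ((h x).trans ?_) (Real.exp_pos _).le
    rw [mul_assoc]
    exact mul_le_mul_of_nonneg_left h1 hK

section GaussAmp

variable {n : ℕ} (η : Fin n → ℝ) {V : Matrix (Fin n) (Fin n) ℝ}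

lemma differentiable_gaussAmp (V : Matrix (Fin n) (Fin n) ℝ) :
    Differentiable ℝ (gaussAmp η V) := by
  unfold gaussAmp Matrix.mulVec dotProduct
  fun_prop

lemma differentiable_mulVec_sub (A : Matrix (Fin n) (Fin n) ℝ) (j : Fin n) :
    Differentiable ℝ fun q => (A *ᵥ (q - η)) j := by
  unfold Matrix.mulVec dotProduct
  fun_prop

lemma pd_eq_of_hasDerivAt {f : (Fin n → ℝ) → ℝ} {q : Fin n → ℝ} {j : Fin n} {d : ℝ}
    (hf : DifferentiableAt ℝ f q)
    (h : HasDerivAt (fun t : ℝ => f (q + t • Pi.single j 1)) d 0) : pd j f q = d := by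
  rw [pd, ← hf.lineDeriv_eq_fderiv]
  exact HasLineDerivAt.lineDeriv h

lemma pd_mulVec_sub (A : Matrix (Fin n) (Fin n) ℝ) (j k : Fin n) (q : Fin n → ℝ) :
    pd j (fun q => (A *ᵥ (q - η)) k) q = A k j := by
  refine pd_eq_of_hasDerivAt (differentiable_mulVec_sub η A k q) ?_
  have h : (fun t : ℝ => (A *ᵥ (q + t • Pi.single j 1 - η)) k)
      = fun t => (A *ᵥ (q - η)) k + t * A k j := by
    funext t
    rw [add_sub_right_comm, mulVec_add, mulVec_smul]
    simp
  rw [h]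
  simpa using ((hasDerivAt_id (0 : ℝ)).mul_const (A k j)).const_add ((A *ᵥ (q - η)) k)

lemma pd_gaussAmp (hV : V.PosDef) (j : Fin n) (q : Fin n → ℝ) :
    pd j (gaussAmp η V) q = -(1 / 2) * (V⁻¹ *ᵥ (q - η)) j * gaussAmp η V q := by
  refine pd_eq_of_hasDerivAt (differentiable_gaussAmp η V q) ?_
  have hsymm : V⁻¹ᵀ = V⁻¹ := by simpa using hV.inv.isHermitian.eq
  set A := V⁻¹ with hA
  have h : ∀ t : ℝ, (q + t • Pi.single j 1 - η) ⬝ᵥ A *ᵥ (q + t • Pi.single j 1 - η)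
      = (q - η) ⬝ᵥ A *ᵥ (q - η) + 2 * t * (A *ᵥ (q - η)) j + t ^ 2 * A j j := by
    intro t
    have h1 : (q - η) ⬝ᵥ A.col j = (A *ᵥ (q - η)) j := by
      conv_rhs => rw [← hsymm]
      rw [dotProduct_comm]; rfl
    rw [add_sub_right_comm, mulVec_add, mulVec_smul]
    simp only [dotProduct_add, add_dotProduct, smul_dotProduct, dotProduct_smul, smul_eq_mul,
      mulVec_single_one, single_one_dotProduct, h1, col_apply]
    ring
  unfold gaussAmp
  simp only [← hA, h]
  have hd : HasDerivAt (fun t : ℝ => -(1 / 4) * ((q - η) ⬝ᵥ A *ᵥ (q - η)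
      + 2 * t * (A *ᵥ (q - η)) j + t ^ 2 * A j j)) (-(1 / 2) * (A *ᵥ (q - η)) j) 0 := by
    have := (((((hasDerivAt_id (0 : ℝ)).const_mul 2).mul_const ((A *ᵥ (q - η)) j)).const_add
      ((q - η) ⬝ᵥ A *ᵥ (q - η))).add
      (((hasDerivAt_id (0 : ℝ)).pow 2).mul_const (A j j))).const_mul (-(1 / 4) : ℝ)
    refine this.congr_deriv ?_
    simp
    ring
  refine (hd.exp.const_mul _).congr_deriv ?_
  simp
  ring

lemma pd_pd_gaussAmp (hV : V.PosDef) (j k : Fin n) (q : Fin n → ℝ) :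
    pd j (pd k (gaussAmp η V)) q =
      (-(1 / 2) * V⁻¹ k j + 1 / 4 * ((V⁻¹ *ᵥ (q - η)) j * (V⁻¹ *ᵥ (q - η)) k)) *
        gaussAmp η V q := by
  rw [funext (pd_gaussAmp η hV k)]
  have h1 := (differentiable_mulVec_sub η V⁻¹ k q).const_mul (-(1 / 2))
  have h2 := differentiable_gaussAmp η V q
  have h3 := pd_mulVec_sub η V⁻¹ j k q
  have h4 := pd_gaussAmp η hV j q
  unfold pd at h3 h4 ⊢
  rw [fderiv_fun_mul h1 h2, fderiv_const_mul (differentiable_mulVec_sub η V⁻¹ k q)]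
  simp only [_root_.add_apply, _root_.smul_apply, smul_eq_mul, h3, h4]
  ring

lemma gaussAmp_sq (hV : V.PosDef) (q : Fin n → ℝ) :
    gaussAmp η V q ^ 2 = (√((2 * Real.pi) ^ n * V.det))⁻¹ *
      Real.exp (-(1 / 2) * ((q - η) ⬝ᵥ V⁻¹ *ᵥ (q - η))) := by
  have hpos : 0 ≤ (2 * Real.pi) ^ n * V.det := by have := hV.det_pos; positivity
  rw [gaussAmp, mul_pow, ← Real.exp_nat_mul, ← Real.rpow_natCast, ← Real.rpow_mul hpos,
    Real.sqrt_eq_rpow, ← Real.rpow_neg hpos]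
  congr 2
  · norm_num
  · push_cast; ring

lemma integral_gaussAmp_sq (hV : V.PosDef) : ∫ q, gaussAmp η V q ^ 2 = 1 := by
  simp only [gaussAmp_sq η hV]
  rw [integral_const_mul,
    integral_sub_right_eq_self (fun x => Real.exp (-(1 / 2) * (x ⬝ᵥ V⁻¹ *ᵥ x))) η,
    hV.inv.integral_exp_neg_mul, det_nonsing_inv, Ring.inverse_eq_inv']
  have hd := hV.det_pos
  rw [Real.sqrt_mul (by positivity), Real.sqrt_inv, inv_inv]
  have h2 : Real.pi / (1 / 2) = 2 * Real.pi := by ring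
  have h3 : √((2 * Real.pi) ^ n) = √(2 * Real.pi) ^ n := by
    rw [Real.sqrt_eq_iff_eq_sq (by positivity) (by positivity), ← pow_mul, mul_comm n, pow_mul,
      Real.sq_sqrt (by positivity)]
  rw [h2, h3]
  field_simp

lemma integrable_gaussAmp_sq (hV : V.PosDef) : Integrable fun q => gaussAmp η V q ^ 2 := by
  simp only [gaussAmp_sq η hV]
  exact ((hV.inv.integrable_exp_neg_mul one_half_pos).comp_sub_right η).const_mul _

lemma integrable_sq_mulVec_mul_gaussAmp_sq (hV : V.PosDef) (j : Fin n) :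
    Integrable fun q => (V⁻¹ *ᵥ (q - η)) j ^ 2 * gaussAmp η V q ^ 2 := by
  simp only [gaussAmp_sq η hV, mul_left_comm _ (√((2 * Real.pi) ^ n * V.det))⁻¹]
  exact ((hV.inv.integrable_sq_mulVec_mul_exp one_half_pos j).comp_sub_right η).const_mul _

lemma integrable_mulVec_mul_mulVec_mul_gaussAmp_sq (hV : V.PosDef) (j k : Fin n) :
    Integrable fun q =>
      (V⁻¹ *ᵥ (q - η)) j * (V⁻¹ *ᵥ (q - η)) k * gaussAmp η V q ^ 2 := by
  refine ((integrable_sq_mulVec_mul_gaussAmp_sq η hV j).add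
    (integrable_sq_mulVec_mul_gaussAmp_sq η hV k)).mono' ?_ ?_
  · exact (((differentiable_mulVec_sub η _ j).continuous.mul
      (differentiable_mulVec_sub η _ k).continuous).mul
      ((differentiable_gaussAmp η V).continuous.pow 2)).aestronglyMeasurable
  · refine Filter.Eventually.of_forall fun q => ?_
    rw [norm_mul, Real.norm_of_nonneg (sq_nonneg (gaussAmp η V q)), Pi.add_apply, ← add_mul]
    gcongr
    rw [Real.norm_eq_abs, abs_le]
    constructor <;> nlinarith [sq_nonneg ((V⁻¹ *ᵥ (q - η)) j + (V⁻¹ *ᵥ (q - η)) k),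
      sq_nonneg ((V⁻¹ *ᵥ (q - η)) j - (V⁻¹ *ᵥ (q - η)) k), sq_nonneg ((V⁻¹ *ᵥ (q - η)) j),
      sq_nonneg ((V⁻¹ *ᵥ (q - η)) k)]

lemma integrable_mulVec_mul_gaussAmp_sq (hV : V.PosDef) (k : Fin n) :
    Integrable fun q => (V⁻¹ *ᵥ (q - η)) k * gaussAmp η V q ^ 2 := by
  refine ((integrable_gaussAmp_sq η hV).add
    (integrable_sq_mulVec_mul_gaussAmp_sq η hV k)).mono' ?_ ?_
  · exact ((differentiable_mulVec_sub η _ k).continuous.mul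
      ((differentiable_gaussAmp η V).continuous.pow 2)).aestronglyMeasurable
  · refine Filter.Eventually.of_forall fun q => ?_
    rw [norm_mul, Real.norm_of_nonneg (sq_nonneg (gaussAmp η V q)), Pi.add_apply,
      ← one_add_mul]
    gcongr
    rw [Real.norm_eq_abs, abs_le]
    constructor <;> nlinarith [sq_nonneg ((V⁻¹ *ᵥ (q - η)) k + 1),
      sq_nonneg ((V⁻¹ *ᵥ (q - η)) k - 1)]

lemma gaussAmp_mul_pd_pd (hV : V.PosDef) (j k : Fin n) (q : Fin n → ℝ) :
    gaussAmp η V q * pd j (pd k (gaussAmp η V)) q =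
      -(1 / 2) * V⁻¹ k j * gaussAmp η V q ^ 2 +
        1 / 4 * ((V⁻¹ *ᵥ (q - η)) j * (V⁻¹ *ᵥ (q - η)) k * gaussAmp η V q ^ 2) := by
  rw [pd_pd_gaussAmp η hV]
  ring

lemma integrable_gaussAmp_mul_pd_pd (hV : V.PosDef) (j k : Fin n) :
    Integrable fun q => gaussAmp η V q * pd j (pd k (gaussAmp η V)) q := by
  simp only [gaussAmp_mul_pd_pd η hV]
  exact ((integrable_gaussAmp_sq η hV).const_mul _).add
    ((integrable_mulVec_mul_mulVec_mul_gaussAmp_sq η hV j k).const_mul _)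

lemma integral_gaussAmp_mul_pd_pd (hV : V.PosDef) (j k : Fin n) :
    ∫ q, gaussAmp η V q * pd j (pd k (gaussAmp η V)) q = -(1 / 4) * V⁻¹ k j := by
  have hpd : ∀ q, pd j (gaussAmp η V) q * pd k (gaussAmp η V) q =
      1 / 4 * ((V⁻¹ *ᵥ (q - η)) j * (V⁻¹ *ᵥ (q - η)) k * gaussAmp η V q ^ 2) := by
    intro q
    rw [pd_gaussAmp η hV, pd_gaussAmp η hV]
    ring
  have hT := integrable_mulVec_mul_mulVec_mul_gaussAmp_sq η hV j k
  have hparts : ∫ q, gaussAmp η V q * pd j (pd k (gaussAmp η V)) q =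
      -∫ q, pd j (gaussAmp η V) q * pd k (gaussAmp η V) q := by
    refine integral_mul_fderiv_eq_neg_fderiv_mul_of_integrable ?_
      (integrable_gaussAmp_mul_pd_pd η hV j k) ?_
      (fun q _ => differentiable_gaussAmp η V q) (fun q _ => ?_)
    · exact (hT.const_mul (1 / 4)).congr (Filter.Eventually.of_forall fun q => (hpd q).symm)
    · refine ((integrable_mulVec_mul_gaussAmp_sq η hV k).const_mul (-(1 / 2))).congr
        (Filter.Eventually.of_forall fun q => ?_)
      simp only [pd_gaussAmp η hV]
      ring
    · rw [funext (pd_gaussAmp η hV k)]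
      exact ((differentiable_mulVec_sub η _ k q).const_mul _).mul (differentiable_gaussAmp η V q)
  have hdirect : ∫ q, gaussAmp η V q * pd j (pd k (gaussAmp η V)) q =
      -(1 / 2) * V⁻¹ k j + 1 / 4 *
        ∫ q, (V⁻¹ *ᵥ (q - η)) j * (V⁻¹ *ᵥ (q - η)) k * gaussAmp η V q ^ 2 := by
    simp only [gaussAmp_mul_pd_pd η hV]
    rw [integral_add ((integrable_gaussAmp_sq η hV).const_mul _) (hT.const_mul _),
      integral_const_mul, integral_const_mul, integral_gaussAmp_sq η hV, mul_one]
  simp only [hpd, integral_const_mul] at hparts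
  linarith

end GaussAmp

/-- for the Gaussian amplitude with covariance `V`,
`⟨Q⟩ = (ħ²/8) Tr(V⁻¹ M)`. -/
theorem meanQ_gaussian {n : ℕ} (hn : 1 ≤ n) (hbar : ℝ) (hhbar : 0 < hbar)
    (η : Fin n → ℝ) (V : Matrix (Fin n) (Fin n) ℝ) (hV : V.PosDef)
    (M : Matrix (Fin n) (Fin n) ℝ) (hM : M.PosDef) :
    meanQ hbar M (gaussAmp η V) = hbar ^ 2 / 8 * Matrix.trace (V⁻¹ * M) := by
  have hint : ∫ q, gaussAmp η V q * ∑ j, ∑ k, M j k * pd j (pd k (gaussAmp η V)) q =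
      ∑ j, ∑ k, M j k * (-(1 / 4) * V⁻¹ k j) := by
    simp only [Finset.mul_sum, mul_left_comm (gaussAmp η V _)]
    have hI : ∀ j k, Integrable fun q =>
        M j k * (gaussAmp η V q * pd j (pd k (gaussAmp η V)) q) :=
      fun j k => (integrable_gaussAmp_mul_pd_pd η hV j k).const_mul _
    rw [integral_finsetSum _ fun j _ => integrable_finsetSum _ fun k _ => hI j k]
    refine Finset.sum_congr rfl fun j _ => ?_
    rw [integral_finsetSum _ fun k _ => hI j k]
    refine Finset.sum_congr rfl fun k _ => ?_
    rw [integral_const_mul, integral_gaussAmp_mul_pd_pd η hV]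
  rw [meanQ, hint, trace_mul_comm]
  simp only [trace, diag_apply, mul_apply, Finset.mul_sum]
  refine Finset.sum_congr rfl fun j _ => Finset.sum_congr rfl fun k _ => ?_
  ring
end
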